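/- arXiv:1502.04649 — 8 statements merged into one kernel-verified Lean document; each statement's English description precedes it below -/
import Mathlib

section
/- The region C(n11, n22, n12, n21, l11, l22) is monotone nondecreasing in the feedback parameters: for all nonnegative integers n11, n22, n12, n21 and all nonnegative integers l11 ≤ l11' and l22 ≤ l22', one has C(n11, n22, n12, n21, l11, l22) ⊆ C(n11, n22, n12, n21, l11', l22'). In particular the no-feedback region C(n11, n22, n12, n21, 0, 0) is contained in every region C(n11, n22, n12, n21, l11, l22). -/
noncomputable section

/-- Positive part of an integer: `x⁺ = max(x, 0)`. -/
def pp (x : ℤ) : ℤ := max x 0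

/-- Feedback correction term `a_j` for index `j`, where `njj, nji, nij, ljj`
are the channel parameters `n_jj, n_ji, n_ij, l_jj` (as integers). -/
def corr (njj nji nij ljj : ℤ) : ℤ :=
  pp (pp (min ljj (max njj nji) - pp (njj - nji)) - pp (nji - njj)
      - min njj nij + min (pp (njj - nji)) nij)

/-- Capacity region `C(n11, n22, n12, n21, l11, l22)` of the two-user linear
deterministic interference channel with noisy channel-output feedback, as a
subset of `ℝ²` (pairs `(R1, R2)`). -/
def capRegion (n11 n22 n12 n21 l11 l22 : ℕ) : Set (ℝ × ℝ) :=
  {p : ℝ × ℝ | 0 ≤ p.1 ∧ 0 ≤ p.2 ∧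
    -- (1) for (i,j) = (1,2) and (2,1)
    p.1 ≤ ((min (max (n11 : ℤ) (n21 : ℤ)) (max (n11 : ℤ) (n12 : ℤ))) : ℝ) ∧
    p.2 ≤ ((min (max (n22 : ℤ) (n12 : ℤ)) (max (n22 : ℤ) (n21 : ℤ))) : ℝ) ∧
    -- (2) for (i,j) = (1,2) and (2,1)
    p.1 ≤ ((min (max (n11 : ℤ) (n21 : ℤ))
              (max (n11 : ℤ) ((l22 : ℤ) - pp ((n22 : ℤ) - (n21 : ℤ))))) : ℝ) ∧
    p.2 ≤ ((min (max (n22 : ℤ) (n12 : ℤ))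
              (max (n22 : ℤ) ((l11 : ℤ) - pp ((n11 : ℤ) - (n12 : ℤ))))) : ℝ) ∧
    -- (3)
    p.1 + p.2 ≤ ((min (max (n11 : ℤ) (n12 : ℤ) + pp ((n22 : ℤ) - (n12 : ℤ)))
                      (max (n22 : ℤ) (n21 : ℤ) + pp ((n11 : ℤ) - (n21 : ℤ)))) : ℝ) ∧
    -- (4)
    p.1 + p.2 ≤ ((max (pp ((n11 : ℤ) - (n12 : ℤ))) (n21 : ℤ)
                  + max (pp ((n22 : ℤ) - (n21 : ℤ))) (n12 : ℤ)
                  + corr (n11 : ℤ) (n12 : ℤ) (n21 : ℤ) (l11 : ℤ)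
                  + corr (n22 : ℤ) (n21 : ℤ) (n12 : ℤ) (l22 : ℤ)) : ℝ) ∧
    -- (5) for (i,j) = (1,2) and (2,1)
    2 * p.1 + p.2 ≤ ((max (n22 : ℤ) (n21 : ℤ) + max (n11 : ℤ) (n12 : ℤ)
                  + pp ((n11 : ℤ) - (n21 : ℤ))
                  - min (pp ((n22 : ℤ) - (n21 : ℤ))) (n12 : ℤ)
                  + corr (n22 : ℤ) (n21 : ℤ) (n12 : ℤ) (l22 : ℤ)) : ℝ) ∧
    2 * p.2 + p.1 ≤ ((max (n11 : ℤ) (n12 : ℤ) + max (n22 : ℤ) (n21 : ℤ)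
                  + pp ((n22 : ℤ) - (n12 : ℤ))
                  - min (pp ((n11 : ℤ) - (n12 : ℤ))) (n21 : ℤ)
                  + corr (n11 : ℤ) (n12 : ℤ) (n21 : ℤ) (l11 : ℤ)) : ℝ)}

/-- Maximum individual-rate improvement `Δ_1` of user 1 due to feedback. -/
def Delta1 (n11 n22 n12 n21 l11 l22 : ℕ) : ℝ :=
  sSup ((fun R2 : ℝ =>
    sSup {R1 : ℝ | (R1, R2) ∈ capRegion n11 n22 n12 n21 l11 l22} -
    sSup {R1 : ℝ | (R1, R2) ∈ capRegion n11 n22 n12 n21 0 0}) '' {R2 : ℝ | 0 < R2})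

/-- Maximum individual-rate improvement `Δ_2` of user 2 due to feedback. -/
def Delta2 (n11 n22 n12 n21 l11 l22 : ℕ) : ℝ :=
  sSup ((fun R1 : ℝ =>
    sSup {R2 : ℝ | (R1, R2) ∈ capRegion n11 n22 n12 n21 l11 l22} -
    sSup {R2 : ℝ | (R1, R2) ∈ capRegion n11 n22 n12 n21 0 0}) '' {R1 : ℝ | 0 < R1})

/-- Maximum sum-rate improvement `Σ` due to feedback. -/
def SigmaImp (n11 n22 n12 n21 l11 l22 : ℕ) : ℝ :=
  sSup ((fun p : ℝ × ℝ => p.1 + p.2) '' capRegion n11 n22 n12 n21 l11 l22) -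
  sSup ((fun p : ℝ × ℝ => p.1 + p.2) '' capRegion n11 n22 n12 n21 0 0)

theorem pp_mono : Monotone pp := fun _ _ h => max_le_max_right 0 h

theorem corr_mono (njj nji nij : ℤ) : Monotone (corr njj nji nij) := fun _ _ h => by
  unfold corr
  apply pp_mono
  gcongr
  apply pp_mono
  gcongr

theorem capRegion_subset (n11 n22 n12 n21 : ℕ) {l11 l22 l11' l22' : ℕ}
    (h1 : l11 ≤ l11') (h2 : l22 ≤ l22') :
    capRegion n11 n22 n12 n21 l11 l22 ⊆ capRegion n11 n22 n12 n21 l11' l22' := by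
  have z1 : (l11 : ℤ) ≤ l11' := by exact_mod_cast h1
  have z2 : (l22 : ℤ) ≤ l22' := by exact_mod_cast h2
  have c1 := corr_mono n11 n12 n21 z1
  have c2 := corr_mono n22 n21 n12 z2
  rintro p ⟨p1, p2, a1, a2, b1, b2, s, t, u1, u2⟩
  refine ⟨p1, p2, a1, a2, b1.trans ?_, b2.trans ?_, s, t.trans ?_, u1.trans ?_, u2.trans ?_⟩ <;>
    gcongr

/-- monotonicity of the capacity region in the feedback parameters,
and inclusion of the no-feedback region in every region. -/
theorem capRegion_mono :
    (∀ n11 n22 n12 n21 l11 l22 l11' l22' : ℕ, l11 ≤ l11' → l22 ≤ l22' →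
      capRegion n11 n22 n12 n21 l11 l22 ⊆ capRegion n11 n22 n12 n21 l11' l22') ∧
    (∀ n11 n22 n12 n21 l11 l22 : ℕ,
      capRegion n11 n22 n12 n21 0 0 ⊆ capRegion n11 n22 n12 n21 l11 l22) := by
  exact ⟨fun n11 n22 n12 n21 _ _ _ _ h1 h2 => capRegion_subset n11 n22 n12 n21 h1 h2,
    fun n11 n22 n12 n21 l11 l22 =>
      capRegion_subset n11 n22 n12 n21 (Nat.zero_le l11) (Nat.zero_le l22)⟩

end
end

section
/- Reduction to perfect channel-output feedback: for all nonnegative integers n11, n22, n12, n21, if l11 = max(n11, n12) and l22 = max(n22, n21), then the region C(n11, n22, n12, n21, l11, l22) equals the set of pairs (R1, R2) ∈ ℝ² with R1 ≥ 0, R2 ≥ 0 satisfying only: for each (i,j) ∈ {(1,2),(2,1)}, R_i ≤ min(max(n_ii, n_ji), max(n_ii, n_ij)), and R1 + R2 ≤ min(max(n11, n12) + (n22 − n12)⁺, max(n22, n21) + (n11 − n21)⁺) (the Suh–Tse perfect-feedback capacity region). -/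
noncomputable section

/-- With perfect feedback, the correction term and the outer positive parts in it cancel. -/
theorem corr_max_self {a b c : ℤ} (ha : 0 ≤ a) (hb : 0 ≤ b) (hc : 0 ≤ c) :
    corr a b c (max a b) = min a b - min a c + min (pp (a - b)) c := by
  unfold corr pp
  omega

theorem max_sub_pp_sub (a b : ℤ) : max a b - pp (a - b) = b := by
  unfold pp
  omega

/-- With perfect feedback, the sum-rate bound involving both correction terms is the sum of
the two individual cut-set bounds. -/
theorem sum_bound_perfect_feedback {a b c d : ℤ}
    (ha : 0 ≤ a) (hb : 0 ≤ b) (hc : 0 ≤ c) (hd : 0 ≤ d) :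
    max (pp (a - c)) d + max (pp (b - d)) c + corr a c d (max a c) + corr b d c (max b d) =
      max a d + max b c := by
  rw [corr_max_self ha hc hd, corr_max_self hb hd hc]
  unfold pp
  omega

/-- With perfect feedback, the weighted bound `2 R_i + R_j` is the sum of an individual bound
and a sum-rate bound. -/
theorem weighted_bound_perfect_feedback {b c d : ℤ} (a : ℤ)
    (hb : 0 ≤ b) (hc : 0 ≤ c) (hd : 0 ≤ d) :
    max b d + max a c + pp (a - d) - min (pp (b - d)) c + corr b d c (max b d) =
      max a d + (max a c + pp (b - c)) := by
  rw [corr_max_self hb hd hc]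
  unfold pp
  omega

/-- reduction to perfect channel-output feedback
(the Suh-Tse perfect-feedback capacity region). -/
theorem capRegion_perfect_feedback (n11 n22 n12 n21 l11 l22 : ℕ)
    (h1 : l11 = max n11 n12) (h2 : l22 = max n22 n21) :
    capRegion n11 n22 n12 n21 l11 l22 =
    {p : ℝ × ℝ | 0 ≤ p.1 ∧ 0 ≤ p.2 ∧
      p.1 ≤ ((min (max (n11 : ℤ) (n21 : ℤ)) (max (n11 : ℤ) (n12 : ℤ))) : ℝ) ∧
      p.2 ≤ ((min (max (n22 : ℤ) (n12 : ℤ)) (max (n22 : ℤ) (n21 : ℤ))) : ℝ) ∧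
      p.1 + p.2 ≤ ((min (max (n11 : ℤ) (n12 : ℤ) + pp ((n22 : ℤ) - (n12 : ℤ)))
                        (max (n22 : ℤ) (n21 : ℤ) + pp ((n11 : ℤ) - (n21 : ℤ)))) : ℝ)} := by
  subst h1 h2
  have ha := Int.natCast_nonneg n11
  have hb := Int.natCast_nonneg n22
  have hc := Int.natCast_nonneg n12
  have hd := Int.natCast_nonneg n21
  have hl₁ := congrArg (Int.cast : ℤ → ℝ) (max_sub_pp_sub n11 n12)
  have hl₂ := congrArg (Int.cast : ℤ → ℝ) (max_sub_pp_sub n22 n21)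
  have hsum := congrArg (Int.cast : ℤ → ℝ) (sum_bound_perfect_feedback ha hb hc hd)
  have hw₁ := congrArg (Int.cast : ℤ → ℝ) (weighted_bound_perfect_feedback n11 hb hc hd)
  have hw₂ := congrArg (Int.cast : ℤ → ℝ) (weighted_bound_perfect_feedback n22 ha hd hc)
  ext ⟨x, y⟩
  simp only [capRegion, Set.mem_ofPred_eq]
  push_cast at *
  rw [hl₁, hl₂, hsum, hw₁, hw₂]
  simp only [le_min_iff]
  constructor
  · rintro ⟨hx, hy, hx₁, hy₁, -, -, hxy, -⟩
    exact ⟨hx, hy, hx₁, hy₁, hxy⟩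
  · rintro ⟨hx, hy, hx₁, hy₁, hxy⟩
    refine ⟨hx, hy, hx₁, hy₁, ⟨hx₁.1, hx₁.1⟩, ⟨hy₁.1, hy₁.1⟩, hxy, ?_, ?_, ?_⟩ <;>
      linarith [hx₁.1, hy₁.1, hxy.1, hxy.2]

end
end

section
/- Saturation of the feedback parameters: for all nonnegative integers n11, n22, n12, n21, l11, l22, the region is unchanged when each feedback parameter is clipped at the corresponding perfect-feedback value, i.e., C(n11, n22, n12, n21, l11, l22) = C(n11, n22, n12, n21, min(l11, max(n11, n12)), min(l22, max(n22, n21))). In particular, increasing l11 beyond max(n11, n12) or l22 beyond max(n22, n21) does not enlarge the region. -/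
noncomputable section

/-- The correction term depends on the feedback parameter only through its clipped value. -/
theorem corr_min_max (njj nji nij ljj : ℤ) :
    corr njj nji nij (min ljj (max njj nji)) = corr njj nji nij ljj := by
  simp only [corr, min_assoc, min_self]

/-- Clipping the feedback parameter at `max njj nji` leaves the feedback bound on a single rate
unchanged. -/
theorem min_max_sub_pp_clip (nii njj nji ljj : ℤ) :
    min (max nii nji) (max nii (min ljj (max njj nji) - pp (njj - nji))) =
      min (max nii nji) (max nii (ljj - pp (njj - nji))) := by
  unfold pp
  omega

/-- saturation of the feedback parameters at the
perfect-feedback values. -/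
theorem capRegion_saturation (n11 n22 n12 n21 l11 l22 : ℕ) :
    capRegion n11 n22 n12 n21 l11 l22 =
    capRegion n11 n22 n12 n21 (min l11 (max n11 n12)) (min l22 (max n22 n21)) := by
  ext p
  have h₁ := congrArg (Int.cast : ℤ → ℝ) (min_max_sub_pp_clip n11 n22 n21 l22)
  have h₂ := congrArg (Int.cast : ℤ → ℝ) (min_max_sub_pp_clip n22 n11 n12 l11)
  push_cast at h₁ h₂
  simp only [capRegion, Set.mem_ofPred_eq, Nat.cast_min, Nat.cast_max, corr_min_max]
  push_cast
  rw [h₁, h₂]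

end
end

section
/- For the channel with parameters n11 = 20, n22 = 15, n12 = 12, n21 = 13, channel-output feedback never increases the sum-rate: for all nonnegative integers l11 and l22, Σ(20, 15, 12, 13, l11, l22) = 0. -/
noncomputable section

theorem corr_nonneg (njj nji nij ljj : ℤ) : 0 ≤ corr njj nji nij ljj :=
  le_max_right _ _

/-- The maximal sum-rate of this channel is `22`: the pair `(16, 6)` attains it for every
choice of the feedback parameters. -/
theorem isGreatest_sumRate (l11 l22 : ℕ) :
    IsGreatest ((fun p : ℝ × ℝ => p.1 + p.2) '' capRegion 20 15 12 13 l11 l22) 22 := by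
  constructor
  · have h₁ : (0 : ℝ) ≤ (corr 20 12 13 l11 : ℤ) := by exact_mod_cast corr_nonneg _ _ _ _
    have h₂ : (0 : ℝ) ≤ (corr 15 13 12 l22 : ℤ) := by exact_mod_cast corr_nonneg _ _ _ _
    refine ⟨(16, 6), ?_, by norm_num⟩
    simp only [capRegion, Set.mem_ofPred_eq]
    norm_num [pp]
    refine ⟨?_, ?_, ?_⟩ <;> linarith
  · rintro _ ⟨p, ⟨-, -, -, -, -, -, h, -⟩, rfl⟩
    norm_num [pp] at h
    exact h

/-- for n11 = 20, n22 = 15, n12 = 12, n21 = 13, feedback never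
increases the sum-rate. -/
theorem sigma_example1 : ∀ l11 l22 : ℕ, SigmaImp 20 15 12 13 l11 l22 = 0 := by
  intro l11 l22
  rw [SigmaImp, (isGreatest_sumRate l11 l22).csSup_eq, (isGreatest_sumRate 0 0).csSup_eq,
    sub_self]

end
end

section
/- For the channel with parameters n11 = 10, n22 = 10, n12 = 3, n21 = 8, increasing either feedback parameter alone beyond its threshold achieves the maximum sum-rate improvement: for every nonnegative integer l11 ≥ 9, Σ(10, 10, 3, 8, l11, 0) = 1, and for every nonnegative integer l22 ≥ 4, Σ(10, 10, 3, 8, 0, l22) = 1. -/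
noncomputable section

theorem mem_capRegion_example (l11 l22 : ℕ) (p : ℝ × ℝ) :
    p ∈ capRegion 10 10 3 8 l11 l22 ↔
      0 ≤ p.1 ∧ 0 ≤ p.2 ∧ p.1 ≤ 10 ∧ p.2 ≤ 10 ∧ p.1 + p.2 ≤ 12 ∧
      p.1 + p.2 ≤ 11 + corr 10 3 8 l11 + corr 10 8 3 l22 ∧
      2 * p.1 + p.2 ≤ 20 + corr 10 8 3 l22 ∧
      2 * p.2 + p.1 ≤ 20 + corr 10 3 8 l11 := by
  have h (m : ℝ) : min (10 : ℝ) (max 10 m) = 10 := min_eq_left (le_max_left _ _)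
  norm_num [capRegion, pp, h]
  tauto

/-- The symmetric rate pair attains the maximum sum rate. -/
theorem sSup_sumRate_example (l11 l22 : ℕ) :
    sSup ((fun p : ℝ × ℝ => p.1 + p.2) '' capRegion 10 10 3 8 l11 l22) =
      min 12 (11 + (corr 10 3 8 l11 : ℝ) + corr 10 8 3 l22) := by
  have ha : (0 : ℝ) ≤ corr 10 3 8 l11 := Int.cast_nonneg (corr_nonneg _ _ _ _)
  have hb : (0 : ℝ) ≤ corr 10 8 3 l22 := Int.cast_nonneg (corr_nonneg _ _ _ _)
  apply IsGreatest.csSup_eq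
  set s : ℝ := min 12 (11 + (corr 10 3 8 l11 : ℝ) + corr 10 8 3 l22) with hs
  have h0 : 0 ≤ s := le_min (by norm_num) (by linarith)
  have h12 : s ≤ 12 := min_le_left _ _
  have hab : s ≤ 11 + (corr 10 3 8 l11 : ℝ) + corr 10 8 3 l22 := min_le_right _ _
  constructor
  · refine ⟨(s / 2, s / 2), (mem_capRegion_example _ _ _).2 ?_, add_halves s⟩
    refine ⟨?_, ?_, ?_, ?_, ?_, ?_, ?_, ?_⟩ <;> dsimp only <;> linarith
  · rintro _ ⟨p, hp, rfl⟩
    obtain ⟨-, -, -, -, h3, h4, -⟩ := (mem_capRegion_example _ _ _).1 hp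
    exact le_min h3 h4

theorem sSup_sumRate_example_no_feedback :
    sSup ((fun p : ℝ × ℝ => p.1 + p.2) '' capRegion 10 10 3 8 0 0) = 11 := by
  rw [sSup_sumRate_example]
  norm_num [corr, pp]

/-- One unit of total feedback correction suffices for the full sum-rate improvement. -/
theorem sigmaImp_example_eq_one {l11 l22 : ℕ}
    (h : 1 ≤ corr 10 3 8 l11 + corr 10 8 3 l22) : SigmaImp 10 10 3 8 l11 l22 = 1 := by
  have h' : (1 : ℝ) ≤ corr 10 3 8 l11 + corr 10 8 3 l22 := by exact_mod_cast h
  rw [SigmaImp, sSup_sumRate_example_no_feedback, sSup_sumRate_example,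
    min_eq_left (by linarith)]
  norm_num

/-- for n11 = 10, n22 = 10, n12 = 3, n21 = 8, increasing either
feedback parameter alone beyond its threshold achieves the maximum sum-rate
improvement. -/
theorem sigma_example2_thresholds :
    (∀ l11 : ℕ, 9 ≤ l11 → SigmaImp 10 10 3 8 l11 0 = 1) ∧
    (∀ l22 : ℕ, 4 ≤ l22 → SigmaImp 10 10 3 8 0 l22 = 1) := by
  refine ⟨fun l hl => sigmaImp_example_eq_one ?_, fun l hl => sigmaImp_example_eq_one ?_⟩ <;>
    simp only [corr, pp] <;> omega

end
end

section
/- For the channel with parameters n11 = 10, n22 = 20, n12 = 6, n21 = 12 and feedback parameters l11 = 10, l22 = 11, the maximum improvement of the individual rate of user 1 equals Δ_1(10, 20, 6, 12, 10, 11) = 3/2. -/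
noncomputable section

/-- With feedback, the region is cut out by `R1 ≤ 10`, `R1 + R2 ≤ 20` and `2 R1 + R2 ≤ 27`. -/
lemma mem_capRegion_feedback (x y : ℝ) : (x, y) ∈ capRegion 10 20 6 12 10 11 ↔
    0 ≤ x ∧ 0 ≤ y ∧ x ≤ 10 ∧ x + y ≤ 20 ∧ 2 * x + y ≤ 27 := by
  norm_num [capRegion, corr, pp]
  intro h1 h2 h3
  constructor
  · rintro ⟨-, h⟩
    constructor <;> linarith
  · rintro ⟨h4, h5⟩
    refine ⟨by linarith, h3, ?_⟩
    repeat' constructor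
    all_goals linarith

/-- Without feedback, the last constraint tightens to `2 R1 + R2 ≤ 24`. -/
lemma mem_capRegion_no_feedback (x y : ℝ) : (x, y) ∈ capRegion 10 20 6 12 0 0 ↔
    0 ≤ x ∧ 0 ≤ y ∧ x ≤ 10 ∧ x + y ≤ 20 ∧ 2 * x + y ≤ 24 := by
  norm_num [capRegion, corr, pp]
  intro h1 h2 h3
  constructor
  · rintro ⟨-, h⟩
    constructor <;> linarith
  · rintro ⟨h4, h5⟩
    refine ⟨by linarith, h3, ?_⟩
    repeat' constructor
    all_goals linarith

lemma sSup_slice {c y : ℝ} (hc : 20 ≤ c) (hy : 0 ≤ y) (hy' : y ≤ 20) :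
    sSup {x : ℝ | 0 ≤ x ∧ 0 ≤ y ∧ x ≤ 10 ∧ x + y ≤ 20 ∧ 2 * x + y ≤ c} =
      min 10 (min (20 - y) ((c - y) / 2)) := by
  apply IsGreatest.csSup_eq
  constructor
  · have h1 := min_le_left 10 (min (20 - y) ((c - y) / 2))
    have h2 := (min_le_right 10 (min (20 - y) ((c - y) / 2))).trans (min_le_left _ _)
    have h3 := (min_le_right 10 (min (20 - y) ((c - y) / 2))).trans (min_le_right _ _)
    refine ⟨le_min (by norm_num) (le_min ?_ ?_), hy, h1, ?_, ?_⟩ <;> linarith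
  · rintro x ⟨-, -, h1, h2, h3⟩
    refine le_min h1 (le_min ?_ ?_) <;> linarith

lemma sSup_slice_of_lt {c y : ℝ} (hy : 20 < y) :
    sSup {x : ℝ | 0 ≤ x ∧ 0 ≤ y ∧ x ≤ 10 ∧ x + y ≤ 20 ∧ 2 * x + y ≤ c} = 0 := by
  convert Real.sSup_empty
  ext x
  simp only [Set.mem_ofPred_eq, Set.mem_empty_iff_false, iff_false]
  rintro ⟨h1, -, -, h2, -⟩
  linarith

/-- Δ_1(10, 20, 6, 12, 10, 11) = 3/2. -/
theorem delta1_example3 : Delta1 10 20 6 12 10 11 = 3 / 2 := by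
  simp only [Delta1, mem_capRegion_feedback, mem_capRegion_no_feedback]
  apply IsGreatest.csSup_eq
  constructor
  · refine ⟨10, by norm_num, ?_⟩
    simp only
    rw [sSup_slice (by norm_num) (by norm_num) (by norm_num),
      sSup_slice (by norm_num) (by norm_num) (by norm_num)]
    norm_num
  · rintro _ ⟨y, hy, rfl⟩
    have hy0 : 0 < y := hy
    rcases le_or_gt y 20 with h | h
    · simp only
      rw [sSup_slice (by norm_num) hy0.le h, sSup_slice (by norm_num) hy0.le h,
        sub_le_iff_le_add, ← min_add_add_left, ← min_add_add_left]
      refine le_min ?_ (le_min ?_ ?_)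
      · exact (min_le_left _ _).trans (by norm_num)
      · exact ((min_le_right _ _).trans (min_le_left _ _)).trans (by linarith)
      · exact ((min_le_right _ _).trans (min_le_right _ _)).trans (by linarith)
    · simp only
      rw [sSup_slice_of_lt h, sSup_slice_of_lt h]
      norm_num


end
end

section
/- For the channel with parameters n11 = 10, n22 = 20, n12 = 6, n21 = 12, the feedback parameter of link 1 has no effect on the capacity region: for all nonnegative integers l11 and l22, C(10, 20, 6, 12, l11, l22) = C(10, 20, 6, 12, 0, l22). -/
noncomputable section

theorem pp_nonneg (x : ℤ) : 0 ≤ pp x := le_max_right _ _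

/-- For these parameters the constraints in which `l11` occurs are implied by
`R1 + R2 ≤ 20` and `R2 ≤ 20`. -/
theorem capRegion_example3_subset (l11 l11' l22 : ℕ) :
    capRegion 10 20 6 12 l11 l22 ⊆ capRegion 10 20 6 12 l11' l22 := by
  rintro p ⟨h1, h2, h3, h4, h5, -, h7, -, h9, -⟩
  have hR2 : p.2 ≤ 20 := h4.trans (by norm_num)
  have hsum : p.1 + p.2 ≤ 20 := h7.trans (by norm_num [pp])
  have ha1 : (0 : ℝ) ≤ (corr 10 6 12 l11' : ℤ) :=
    Int.cast_nonneg (corr_nonneg _ _ _ _)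
  have ha2 : (0 : ℝ) ≤ (corr 20 12 6 l22 : ℤ) :=
    Int.cast_nonneg (corr_nonneg _ _ _ _)
  refine ⟨h1, h2, h3, h4, h5, le_min (hR2.trans ?_) (hR2.trans ?_), h7,
    hsum.trans ?_, h9, ?_⟩
  · norm_num
  · exact le_max_of_le_left (by norm_num)
  · norm_num [pp]
    linarith
  · norm_num [pp]
    linarith

/-- for n11 = 10, n22 = 20, n12 = 6, n21 = 12, the feedback
parameter of link 1 has no effect on the capacity region. -/
theorem capRegion_example3_l11_useless :
    ∀ l11 l22 : ℕ, capRegion 10 20 6 12 l11 l22 = capRegion 10 20 6 12 0 l22 := by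
  intro l11 l22
  exact (capRegion_example3_subset l11 0 l22).antisymm (capRegion_example3_subset 0 l11 l22)

end
end

section
/- For the channel with parameters n11 = 10, n22 = 9, n12 = 2, n21 = 15, channel-output feedback is completely useless: for all nonnegative integers l11 and l22, C(10, 9, 2, 15, l11, l22) = C(10, 9, 2, 15, 0, 0), i.e., the capacity regions with and without channel-output feedback are identical even with perfect (noiseless) feedback links. -/
noncomputable section

/-- The feedback-dependent bounds are all implied by the individual rate bounds and
the sum-rate bound `R₁ + R₂ ≤ 15`. -/
theorem mem_capRegion_example5_iff (l11 l22 : ℕ) (p : ℝ × ℝ) :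
    p ∈ capRegion 10 9 2 15 l11 l22 ↔
      0 ≤ p.1 ∧ 0 ≤ p.2 ∧ p.1 ≤ 10 ∧ p.2 ≤ 9 ∧ p.1 + p.2 ≤ 15 := by
  have h₁ : (0 : ℝ) ≤ (corr 10 2 15 l11 : ℤ) := by exact_mod_cast corr_nonneg _ _ _ _
  have h₂ : (0 : ℝ) ≤ (corr 9 15 2 l22 : ℤ) := by exact_mod_cast corr_nonneg _ _ _ _
  simp only [capRegion, Set.mem_ofPred_eq, pp]
  norm_num
  intro _ _ hR₁ hR₂
  refine ⟨fun h => h.2.2.1, fun hsum => ⟨⟨?_, Or.inl hR₁⟩, hR₂, hsum, ?_, ?_, ?_⟩⟩ <;> linarith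

/-- for n11 = 10, n22 = 9, n12 = 2, n21 = 15, channel-output
feedback is completely useless. -/
theorem capRegion_example5_feedback_useless :
    ∀ l11 l22 : ℕ, capRegion 10 9 2 15 l11 l22 = capRegion 10 9 2 15 0 0 := by
  intro l11 l22
  ext p
  rw [mem_capRegion_example5_iff, mem_capRegion_example5_iff]

end
end
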